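/- arXiv:1807.04125 — 4 statements merged into one kernel-verified Lean document; each statement's English description precedes it below -/
import Mathlib

section
/- Let λ be a nonzero real number, let β, α be real numbers with β ≥ 1 and α > 1, and suppose α = 2βm + 1 for a positive integer m. Define, for y > 0, F(y) = (1/λ) · y^{1-2β-α}/(1-2β-α) + (-1)^{m+1} (λ^{2m+1}/Γ(2m+3)) · log y + ∑_{n=-m}^{-1} (-1)^{n+m+1} (λ^{2n+2m+1}/Γ(2n+2m+3)) · y^{2βn}/(2βn) + ∑_{n=0}^{∞} (-1)^{n+m} (λ^{2n+2m+3}/Γ(2n+2m+5)) · y^{2βn+2β}/(2βn+2β). Then for every x > 0, F is differentiable at x and F′(x) = cos(λ x^β)/(λ x^{2β+α}). -/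
open Real

/-- The `k`-th term of the cosine series of `lam * x ^ β`, divided by `lam * x ^ p`. -/
lemma cos_term_div_rpow {lam x : ℝ} (β p : ℝ) (hx : 0 < x) (k : ℕ) :
    (-1 : ℝ) ^ k * (lam * x ^ β) ^ (2 * k) / (2 * k).factorial / (lam * x ^ p) =
      (-1 : ℝ) ^ k * (lam ^ (2 * k) / lam / (2 * k).factorial) * x ^ (2 * β * k - p) := by
  have h : x ^ (2 * β * k - p) = (x ^ β) ^ (2 * k) / x ^ p := by
    rw [rpow_sub hx, ← rpow_natCast (x ^ β), ← rpow_mul hx.le]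
    congr 2
    push_cast
    ring
  rw [h, mul_pow]
  field_simp

/-- Derivative of `y ^ r / r` scaled by a constant. -/
lemma hasDerivAt_const_mul_rpow_div (c : ℝ) {r x : ℝ} (hr : r ≠ 0) (hx : 0 < x) :
    HasDerivAt (fun y : ℝ => c * (y ^ r / r)) (c * x ^ (r - 1)) x := by
  have h := ((hasDerivAt_rpow_const (p := r) (Or.inl hx.ne')).div_const r).const_mul c
  rwa [mul_div_cancel_left₀ _ hr] at h

/-- Termwise differentiation of a generalized power series on the positive half-line. -/
lemma hasDerivAt_tsum_rpow_div {c r : ℕ → ℝ} (hr : ∀ n, 1 ≤ r n)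
    (hsum : ∀ z : ℝ, 0 < z → Summable fun n => c n * z ^ (r n - 1)) {x : ℝ} (hx : 0 < x) :
    HasDerivAt (fun y : ℝ => ∑' n, c n * (y ^ r n / r n)) (∑' n, c n * x ^ (r n - 1)) x := by
  have hx' : x ∈ Set.Ioo 0 (x + 1) := ⟨hx, by linarith⟩
  refine hasDerivAt_tsum_of_isPreconnected (hsum (x + 1) (by linarith)).abs isOpen_Ioo
    isPreconnected_Ioo
    (fun n y hy => hasDerivAt_const_mul_rpow_div (c n) (by linarith [hr n]) hy.1)
    (fun n y hy => ?_) hx' ?_ hx'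
  · rw [norm_eq_abs, abs_mul, abs_mul, abs_of_nonneg (rpow_nonneg hy.1.le _),
      abs_of_nonneg (rpow_nonneg (by linarith [hy.1, hy.2]) _)]
    exact mul_le_mul_of_nonneg_left
      (rpow_le_rpow hy.1.le hy.2.le (by linarith [hr n])) (abs_nonneg _)
  · refine Summable.of_norm_bounded (((hsum x hx).mul_left x).abs) fun n => ?_
    have hrn : 0 < r n := by linarith [hr n]
    have e : x * (c n * x ^ (r n - 1)) = c n * x ^ r n := by
      rw [rpow_sub_one hx.ne']
      field_simp
    rw [e, norm_eq_abs, abs_mul, abs_mul]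
    refine mul_le_mul_of_nonneg_left ?_ (abs_nonneg _)
    rw [abs_div, abs_of_pos hrn]
    exact div_le_self (abs_nonneg _) (hr n)

/-- A sum over the integers in `[-m, -1]` as a sum over `range m`. -/
lemma sum_Icc_neg_eq_sum_range {M : Type*} [AddCommMonoid M] (m : ℕ) (f : ℤ → M) :
    ∑ n ∈ Finset.Icc (-(m : ℤ)) (-1), f n = ∑ i ∈ Finset.range m, f (i - m) := by
  symm
  refine Finset.sum_bij (fun i _ => (i : ℤ) - m) ?_ ?_ ?_ fun _ _ => rfl
  · intro i hi
    simp only [Finset.mem_range, Finset.mem_Icc] at *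
    omega
  · intro i _ j _ h
    simpa using h
  · intro n hn
    simp only [Finset.mem_Icc] at hn
    exact ⟨(n + m).toNat, by simp only [Finset.mem_range]; omega, by omega⟩

/-- Theorem 3, case ε = 1 (cosine integral with `α = 2βm + 1`). -/
theorem cos_integral_eps_one (lam β α : ℝ) (hlam : lam ≠ 0) (hβ : 1 ≤ β) (hα : 1 < α)
    (m : ℕ) (hm : 0 < m) (hαm : α = 2 * β * m + 1) :
    ∀ x : ℝ, 0 < x →
      HasDerivAt (fun y : ℝ =>
        (1 / lam) * (y ^ (1 - 2 * β - α) / (1 - 2 * β - α)) +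
        (-1 : ℝ) ^ (m + 1) * (lam ^ (2 * m + 1) / Real.Gamma (2 * (m : ℝ) + 3)) * Real.log y +
        (∑ n ∈ Finset.Icc (-(m : ℤ)) (-1 : ℤ),
          (-1 : ℝ) ^ (n + (m : ℤ) + 1) *
            (lam ^ (2 * n + 2 * (m : ℤ) + 1) / Real.Gamma (2 * (n : ℝ) + 2 * (m : ℝ) + 3)) *
            (y ^ (2 * β * (n : ℝ)) / (2 * β * (n : ℝ)))) +
        ∑' n : ℕ,
          (-1 : ℝ) ^ (n + m) *
            (lam ^ (2 * n + 2 * m + 3) / Real.Gamma (2 * (n : ℝ) + 2 * (m : ℝ) + 5)) *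
            (y ^ (2 * β * (n : ℝ) + 2 * β) / (2 * β * (n : ℝ) + 2 * β)))
        (Real.cos (lam * x ^ β) / (lam * x ^ (2 * β + α))) x := by
  intro x hx
  have hβ0 : 0 < β := by linarith
  have hser (z : ℝ) (hz : 0 < z) :
      HasSum (fun k : ℕ => (-1 : ℝ) ^ k * (lam ^ (2 * k) / lam / (2 * k).factorial) *
        z ^ (2 * β * k - (2 * β + α))) (cos (lam * z ^ β) / (lam * z ^ (2 * β + α))) := by
    simpa only [cos_term_div_rpow β _ hz] using
      (hasSum_cos (lam * z ^ β)).div_const (lam * z ^ (2 * β + α))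
  have htail (z : ℝ) (n : ℕ) :
      (-1 : ℝ) ^ (n + (m + 2)) *
        (lam ^ (2 * (n + (m + 2))) / lam / (2 * (n + (m + 2))).factorial) *
        z ^ (2 * β * (n + (m + 2) : ℕ) - (2 * β + α)) =
      (-1 : ℝ) ^ (n + m) *
        (lam ^ (2 * n + 2 * m + 3) / Gamma (2 * (n : ℝ) + 2 * (m : ℝ) + 5)) *
        z ^ (2 * β * (n : ℝ) + 2 * β - 1) := by
    have hG : Gamma (2 * (n : ℝ) + 2 * (m : ℝ) + 5) = (2 * (n + (m + 2))).factorial := by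
      rw [← Gamma_nat_eq_factorial]
      congr 1
      push_cast
      ring
    rw [hG, show 2 * (n + (m + 2)) = 2 * n + 2 * m + 3 + 1 by ring, pow_succ lam,
      mul_div_cancel_right₀ _ hlam, hαm]
    congr 2
    · ring
    · push_cast
      ring
  have hmid (i : ℕ) :
      (-1 : ℝ) ^ (i + 1) * (lam ^ (2 * (i + 1)) / lam / (2 * (i + 1)).factorial) *
        x ^ (2 * β * (i + 1 : ℕ) - (2 * β + α)) =
      (-1 : ℝ) ^ (((i : ℤ) - m) + (m : ℤ) + 1) *
        (lam ^ (2 * ((i : ℤ) - m) + 2 * (m : ℤ) + 1) /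
          Gamma (2 * (((i : ℤ) - m : ℤ) : ℝ) + 2 * (m : ℝ) + 3)) *
        x ^ (2 * β * (((i : ℤ) - m : ℤ) : ℝ) - 1) := by
    have hG : Gamma (2 * (((i : ℤ) - m : ℤ) : ℝ) + 2 * (m : ℝ) + 3) =
        (2 * (i + 1)).factorial := by
      rw [← Gamma_nat_eq_factorial]
      congr 1
      push_cast
      ring
    rw [hG, show ((i : ℤ) - m) + (m : ℤ) + 1 = ((i + 1 : ℕ) : ℤ) by push_cast; ring,
      show 2 * ((i : ℤ) - m) + 2 * (m : ℤ) + 1 = ((2 * i + 1 : ℕ) : ℤ) by push_cast; ring,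
      zpow_natCast, zpow_natCast, show lam ^ (2 * (i + 1)) = lam ^ (2 * i + 1) * lam by ring,
      mul_div_cancel_right₀ _ hlam, hαm]
    congr 2
    push_cast
    ring
  have hlog :
      (-1 : ℝ) ^ (m + 1) * (lam ^ (2 * (m + 1)) / lam / (2 * (m + 1)).factorial) *
        x ^ (2 * β * (m + 1 : ℕ) - (2 * β + α)) =
      (-1 : ℝ) ^ (m + 1) * (lam ^ (2 * m + 1) / Gamma (2 * (m : ℝ) + 3)) * x⁻¹ := by
    have h := hmid m
    simp only [sub_self, Int.cast_zero, mul_zero, zero_add, zero_sub, rpow_neg_one] at h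
    rw [h]
    norm_cast
  have hS := (hser x hx).tsum_eq
  rw [← (hser x hx).summable.sum_add_tsum_nat_add (m + 2), Finset.sum_range_succ,
    Finset.sum_range_succ', hlog, Finset.sum_congr rfl fun i _ => hmid i,
    tsum_congr (htail x)] at hS
  rw [← hS]
  have h1 := hasDerivAt_const_mul_rpow_div (1 / lam)
    (r := 1 - 2 * β - α) (by linarith) hx
  have h2 := (hasDerivAt_log hx.ne').const_mul
    ((-1 : ℝ) ^ (m + 1) * (lam ^ (2 * m + 1) / Gamma (2 * (m : ℝ) + 3)))
  have h3 := HasDerivAt.fun_sum (u := Finset.Icc (-(m : ℤ)) (-1)) fun n hn =>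
    hasDerivAt_const_mul_rpow_div ((-1 : ℝ) ^ (n + (m : ℤ) + 1) *
      (lam ^ (2 * n + 2 * (m : ℤ) + 1) / Gamma (2 * (n : ℝ) + 2 * (m : ℝ) + 3)))
      (r := 2 * β * (n : ℝ)) (by
        have hn0 : n ≠ 0 := by
          rw [Finset.mem_Icc] at hn
          omega
        have : (n : ℝ) ≠ 0 := by exact_mod_cast hn0
        positivity) hx
  have h4 := hasDerivAt_tsum_rpow_div
    (c := fun n : ℕ => (-1 : ℝ) ^ (n + m) *
      (lam ^ (2 * n + 2 * m + 3) / Gamma (2 * (n : ℝ) + 2 * (m : ℝ) + 5)))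
    (r := fun n : ℕ => 2 * β * (n : ℝ) + 2 * β)
    (fun n => by
      have : 0 ≤ 2 * β * (n : ℝ) := by positivity
      linarith)
    (fun z hz => by
      simpa only [htail] using (summable_nat_add_iff (m + 2)).2 (hser z hz).summable) hx
  refine (((h1.add h2).add h3).add h4).congr_deriv ?_
  rw [sum_Icc_neg_eq_sum_range]
  have h0 : 1 - 2 * β - α - 1 = -(2 * β + α) := by ring
  simp only [h0, pow_zero, mul_zero, Nat.factorial_zero, Nat.cast_zero, Nat.cast_one, div_one,
    one_mul, zero_sub]
  ring
end

section
/- Let λ be a nonzero real number, let β, α be real numbers with β > 1 and α > 1, and suppose α = mβ for a positive integer m. Define, for y > 0, F(y) = (1/λ) · y^{1-β-α}/(1-β-α) + ∑_{n=-m}^{-1} (λ^{n+m}/Γ(n+m+2)) · y^{βn+1}/(βn+1) + ∑_{n=0}^{∞} (λ^{n+m}/Γ(n+m+2)) · y^{βn+1}/(βn+1). Then for every x > 0, F is differentiable at x and F′(x) = exp(λ x^β)/(λ x^{β+α}). -/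
open Real

/-- The Gamma function at a shifted natural number, as a factorial. -/
lemma gamma_natCast_add_two (k : ℕ) : Real.Gamma ((k : ℝ) + 2) = ((k + 1).factorial : ℝ) := by
  rw [← Real.Gamma_nat_eq_factorial]
  congr 1
  push_cast
  ring

/-- A power function with its natural antiderivative normalisation. -/
lemma hasDerivAt_rpow_add_one_div {r x : ℝ} (hr : r + 1 ≠ 0) (hx : 0 < x) :
    HasDerivAt (fun y : ℝ => y ^ (r + 1) / (r + 1)) (x ^ r) x := by
  have h := (Real.hasDerivAt_rpow_const (p := r + 1) (Or.inl hx.ne')).div_const (r + 1)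
  rwa [add_sub_cancel_right, mul_div_cancel_left₀ _ hr] at h

/-- The exponential series without its constant term, divided by `z`. -/
lemma hasSum_pow_div_factorial_succ {z : ℝ} (hz : z ≠ 0) :
    HasSum (fun k : ℕ => z ^ k / ((k + 1).factorial : ℝ)) ((Real.exp z - 1) / z) := by
  have h : HasSum (fun k : ℕ => z ^ k / (k.factorial : ℝ)) (Real.exp z) := by
    rw [Real.exp_eq_exp_ℝ]
    exact NormedSpace.expSeries_div_hasSum_exp z
  have h1 := ((hasSum_nat_add_iff' 1).mpr h).div_const z
  simp only [Finset.sum_range_one, pow_zero, Nat.factorial_zero, Nat.cast_one, div_one] at h1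
  refine h1.congr_fun fun k => ?_
  field_simp
  ring

/-- Termwise differentiation of the power series part. -/
lemma hasDerivAt_tsum_rpow (lam β : ℝ) (hβ : 0 < β) (m : ℕ) {x : ℝ} (hx : 0 < x) :
    HasDerivAt (fun y : ℝ => ∑' n : ℕ, (lam ^ (n + m) / ((n + m + 1).factorial : ℝ)) *
        (y ^ (β * (n : ℝ) + 1) / (β * (n : ℝ) + 1)))
      (∑' n : ℕ, (lam ^ (n + m) / ((n + m + 1).factorial : ℝ)) * x ^ (β * (n : ℝ))) x := by
  have hne : ∀ n : ℕ, β * (n : ℝ) + 1 ≠ 0 := fun n => by positivity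
  have hu : Summable fun n : ℕ =>
      |lam| ^ m * ((|lam| * (x + 1) ^ β) ^ n / (n.factorial : ℝ)) :=
    (Real.summable_pow_div_factorial _).mul_left _
  have hbound : ∀ (n : ℕ) (y : ℝ), y ∈ Set.Ioo 0 (x + 1) →
      ‖(lam ^ (n + m) / ((n + m + 1).factorial : ℝ)) * y ^ (β * (n : ℝ))‖ ≤
        |lam| ^ m * ((|lam| * (x + 1) ^ β) ^ n / (n.factorial : ℝ)) := by
    intro n y hy
    have hy0 : 0 < y := hy.1
    rw [norm_mul, norm_div, norm_pow, Real.norm_eq_abs, Real.norm_natCast,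
      Real.norm_of_nonneg (by positivity), Real.rpow_mul hy0.le, Real.rpow_natCast]
    calc |lam| ^ (n + m) / ((n + m + 1).factorial : ℝ) * (y ^ β) ^ n
        ≤ |lam| ^ (n + m) / (n.factorial : ℝ) * ((x + 1) ^ β) ^ n := by
          gcongr
          · omega
          · exact hy.2.le
      _ = _ := by rw [mul_pow, pow_add]; ring
  have hxt : x ∈ Set.Ioo 0 (x + 1) := ⟨hx, by linarith⟩
  refine hasDerivAt_tsum_of_isPreconnected hu isOpen_Ioo isPreconnected_Ioo
    (fun n y hy => (hasDerivAt_rpow_add_one_div (hne n) hy.1).const_mul _) hbound hxt ?_ hxt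
  refine Summable.of_norm_bounded (hu.mul_right x) fun n => ?_
  have hn : (1 : ℝ) ≤ β * n + 1 := by
    have : 0 ≤ β * (n : ℝ) := by positivity
    linarith
  have hle : x ^ (β * (n : ℝ) + 1) / (β * n + 1) ≤ x ^ (β * (n : ℝ)) * x := by
    rw [← Real.rpow_add_one hx.ne']
    exact div_le_self (by positivity) hn
  calc _ ≤ ‖(lam ^ (n + m) / ((n + m + 1).factorial : ℝ)) * x ^ (β * (n : ℝ))‖ * x := by
        rw [norm_mul, norm_mul, mul_assoc, Real.norm_of_nonneg (r := x ^ _ / _) (by positivity),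
          Real.norm_of_nonneg (r := x ^ _) (by positivity)]
        gcongr
    _ ≤ _ := mul_le_mul_of_nonneg_right (hbound n x hxt) hx.le

/-- Theorem 5, case ε = 0 (exponential integral with `α = mβ`, `β > 1`). -/
theorem exp_integral_eps_zero (lam β α : ℝ) (hlam : lam ≠ 0) (hβ : 1 < β) (hα : 1 < α)
    (m : ℕ) (hm : 0 < m) (hαm : α = m * β) :
    ∀ x : ℝ, 0 < x →
      HasDerivAt (fun y : ℝ =>
        (1 / lam) * (y ^ (1 - β - α) / (1 - β - α)) +
        (∑ n ∈ Finset.Icc (-(m : ℤ)) (-1 : ℤ),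
          (lam ^ (n + (m : ℤ)) / Real.Gamma ((n : ℝ) + (m : ℝ) + 2)) *
            (y ^ (β * (n : ℝ) + 1) / (β * (n : ℝ) + 1))) +
        ∑' n : ℕ,
          (lam ^ (n + m) / Real.Gamma ((n : ℝ) + (m : ℝ) + 2)) *
            (y ^ (β * (n : ℝ) + 1) / (β * (n : ℝ) + 1)))
        (Real.exp (lam * x ^ β) / (lam * x ^ (β + α))) x := by
  intro x hx
  have hfirst : HasDerivAt (fun y : ℝ => (1 / lam) * (y ^ (1 - β - α) / (1 - β - α)))
      ((1 / lam) * x ^ (-(β + α))) x := by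
    have h := (hasDerivAt_rpow_add_one_div (r := -(β + α)) (by linarith) hx).const_mul (1 / lam)
    rwa [show -(β + α) + 1 = 1 - β - α by ring] at h
  have hfinite : HasDerivAt (fun y : ℝ => ∑ n ∈ Finset.Icc (-(m : ℤ)) (-1 : ℤ),
      (lam ^ (n + (m : ℤ)) / Real.Gamma ((n : ℝ) + (m : ℝ) + 2)) *
        (y ^ (β * (n : ℝ) + 1) / (β * (n : ℝ) + 1)))
      (∑ n ∈ Finset.Icc (-(m : ℤ)) (-1 : ℤ),
        (lam ^ (n + (m : ℤ)) / Real.Gamma ((n : ℝ) + (m : ℝ) + 2)) * x ^ (β * (n : ℝ))) x := by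
    refine HasDerivAt.fun_sum fun n hn => (hasDerivAt_rpow_add_one_div ?_ hx).const_mul _
    have hn1 : (n : ℝ) ≤ -1 := by exact_mod_cast (Finset.mem_Icc.mp hn).2
    nlinarith
  have hgamma : ∀ n : ℕ, Real.Gamma ((n : ℝ) + (m : ℝ) + 2) = ((n + m + 1).factorial : ℝ) :=
    fun n => by rw [← Nat.cast_add, gamma_natCast_add_two]
  have hseries := hasDerivAt_tsum_rpow lam β (by linarith) m hx
  simp only [← hgamma] at hseries
  refine ((hfirst.add hfinite).add hseries).congr_deriv ?_
  set z := lam * x ^ β with hz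
  have hxβ : x ^ β ≠ 0 := (Real.rpow_pos_of_pos hx β).ne'
  have hxα : x ^ α ≠ 0 := (Real.rpow_pos_of_pos hx α).ne'
  have hz0 : z ≠ 0 := mul_ne_zero hlam hxβ
  set f : ℕ → ℝ := fun k => z ^ k / ((k + 1).factorial : ℝ) / x ^ α with hf
  have hfsum : HasSum f ((Real.exp z - 1) / z / x ^ α) :=
    (hasSum_pow_div_factorial_succ hz0).div_const _
  have hfterm : ∀ (k : ℕ) (r : ℝ), r + m = k →
      f k = lam ^ k / ((k + 1).factorial : ℝ) * x ^ (β * r) := by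
    intro k r hr
    have hexp : β * r = β * k - α := by rw [← hr, hαm]; ring
    rw [hexp, Real.rpow_sub hx, Real.rpow_mul hx.le, Real.rpow_natCast, hf]
    simp only [hz, mul_pow]
    ring
  have hlow : ∑ n ∈ Finset.Icc (-(m : ℤ)) (-1 : ℤ),
      (lam ^ (n + (m : ℤ)) / Real.Gamma ((n : ℝ) + (m : ℝ) + 2)) * x ^ (β * (n : ℝ)) =
      ∑ k ∈ Finset.range m, f k := by
    refine Finset.sum_bij' (fun n _ => (n + m).toNat) (fun k _ => (k : ℤ) - m) ?_ ?_ ?_ ?_ ?_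
    · intro n hn
      simp only [Finset.mem_Icc, Finset.mem_range] at *
      omega
    · intro n hn
      simp only [Finset.mem_Icc, Finset.mem_range] at *
      omega
    · intro n hn
      simp only [Finset.mem_Icc] at *
      omega
    · intro n hn
      simp
    · intro n hn
      obtain ⟨k, hk⟩ := Int.eq_ofNat_of_zero_le
        (show 0 ≤ n + (m : ℤ) by simp only [Finset.mem_Icc] at hn; omega)
      have hkr : (n : ℝ) + m = k := by exact_mod_cast hk
      rw [hkr, gamma_natCast_add_two, hk, zpow_natCast, Int.toNat_natCast, hfterm k n hkr]
  have hhigh : ∑' n : ℕ, (lam ^ (n + m) / Real.Gamma ((n : ℝ) + (m : ℝ) + 2)) *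
      x ^ (β * (n : ℝ)) = ∑' n : ℕ, f (n + m) :=
    tsum_congr fun n => by rw [hgamma, hfterm (n + m) n (by push_cast; ring)]
  rw [hlow, hhigh, add_assoc, hfsum.summable.sum_add_tsum_nat_add, hfsum.tsum_eq,
    Real.rpow_neg hx.le, Real.rpow_add hx, hz]
  field_simp
  ring
end

section
/- Let λ be a nonzero real number, let β, α be real numbers with β ≥ 1 and α > 1, let m be a natural number and ε a real number with -β < ε < β, ε ≠ 0, ε ≠ 1, such that α = mβ + ε, and assume additionally that ε ≠ βn + 1 for every integer n with -m ≤ n ≤ -1. Define, for y > 0, F(y) = (1/λ) · y^{1-β-α}/(1-β-α) + (λ^{m}/Γ(m+2)) · y^{1-ε}/(1-ε) + ∑_{n=-m}^{-1} (λ^{n+m}/Γ(n+m+2)) · y^{βn-ε+1}/(βn-ε+1) + ∑_{n=0}^{∞} (λ^{n+m+1}/Γ(n+m+3)) · y^{βn+β-ε+1}/(βn+β-ε+1). Then for every x > 0, F is differentiable at x and F′(x) = exp(λ x^β)/(λ x^{β+α}). -/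
open Real

/-- The power rule in the normalised form `y ^ s / s`. -/
lemma hasDerivAt_rpow_div {x s : ℝ} (hx : 0 < x) (hs : s ≠ 0) :
    HasDerivAt (fun y : ℝ => y ^ s / s) (x ^ (s - 1)) x := by
  have h := (Real.hasDerivAt_rpow_const (x := x) (p := s) (Or.inl hx.ne')).div_const s
  rwa [mul_div_cancel_left₀ _ hs] at h

lemma Gamma_natCast_add_three (n m : ℕ) :
    Real.Gamma ((n : ℝ) + (m : ℝ) + 3) = ((n + (m + 2)).factorial : ℝ) := by
  rw [← Real.Gamma_nat_eq_factorial]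
  push_cast
  congr 1
  ring

/-- The tail of the exponential series, multiplied by a power of the variable. -/
lemma exp_tail_term (lam β ε : ℝ) (m n : ℕ) {y : ℝ} (hy : 0 < y) (hlam : lam ≠ 0) :
    lam ^ (n + m + 1) / Real.Gamma ((n : ℝ) + (m : ℝ) + 3) * y ^ (β * (n : ℝ) + β - ε) =
      (lam * y ^ β) ^ (n + (m + 2)) / ((n + (m + 2)).factorial : ℝ) /
        (lam * y ^ (β + (m * β + ε))) := by
  have hpow : (y ^ β) ^ (n + (m + 2)) =
      y ^ (β * (n : ℝ) + β - ε) * y ^ (β + (m * β + ε)) := by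
    rw [← Real.rpow_natCast, ← Real.rpow_mul hy.le, ← Real.rpow_add hy]
    push_cast
    congr 1
    ring
  have hy' := (Real.rpow_pos_of_pos hy (β + (m * β + ε))).ne'
  have hf : ((n + (m + 2)).factorial : ℝ) ≠ 0 := by positivity
  rw [Gamma_natCast_add_three, mul_pow, hpow]
  field_simp
  ring

lemma summable_exp_tail (lam β ε : ℝ) (m : ℕ) {y : ℝ} (hy : 0 < y) (hlam : lam ≠ 0) :
    Summable fun n : ℕ =>
      lam ^ (n + m + 1) / Real.Gamma ((n : ℝ) + (m : ℝ) + 3) * y ^ (β * (n : ℝ) + β - ε) := by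
  simp_rw [exp_tail_term lam β ε m _ hy hlam]
  exact ((summable_nat_add_iff (m + 2)).2
    (Real.summable_pow_div_factorial (lam * y ^ β))).div_const _

/-- Termwise differentiation of the power series in `F`. -/
lemma hasDerivAt_tsum_exp_tail (lam β ε : ℝ) (m : ℕ) (hlam : lam ≠ 0) (hβ : 0 < β)
    (hε : ε < β) {x : ℝ} (hx : 0 < x) :
    HasDerivAt (fun y : ℝ => ∑' n : ℕ,
        lam ^ (n + m + 1) / Real.Gamma ((n : ℝ) + (m : ℝ) + 3) *
          (y ^ (β * (n : ℝ) + β - ε + 1) / (β * (n : ℝ) + β - ε + 1)))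
      (∑' n : ℕ, lam ^ (n + m + 1) / Real.Gamma ((n : ℝ) + (m : ℝ) + 3) *
        x ^ (β * (n : ℝ) + β - ε)) x := by
  have hexp (n : ℕ) : 0 < β * (n : ℝ) + β - ε := by
    have : 0 ≤ β * (n : ℝ) := by positivity
    linarith
  refine hasDerivAt_tsum_of_isPreconnected
    (g := fun (n : ℕ) (y : ℝ) => lam ^ (n + m + 1) / Real.Gamma ((n : ℝ) + (m : ℝ) + 3) *
      (y ^ (β * (n : ℝ) + β - ε + 1) / (β * (n : ℝ) + β - ε + 1)))
    (g' := fun (n : ℕ) (y : ℝ) => lam ^ (n + m + 1) / Real.Gamma ((n : ℝ) + (m : ℝ) + 3) *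
      y ^ (β * (n : ℝ) + β - ε))
    (summable_exp_tail lam β ε m (y := x + 1) (by linarith) hlam).norm
    (t := Set.Ioo 0 (x + 1)) isOpen_Ioo isPreconnected_Ioo (fun n y hy => ?_) (fun n y hy => ?_)
    (y₀ := x) ⟨hx, by linarith⟩ ?_ ⟨hx, by linarith⟩
  · have h := hasDerivAt_rpow_div hy.1 (add_pos (hexp n) one_pos).ne'
    rw [add_sub_cancel_right] at h
    exact h.const_mul _
  · rw [norm_mul, norm_mul]
    refine mul_le_mul_of_nonneg_left ?_ (norm_nonneg _)
    rw [Real.norm_of_nonneg (Real.rpow_nonneg hy.1.le _),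
      Real.norm_of_nonneg (Real.rpow_nonneg (by linarith) _)]
    exact Real.rpow_le_rpow hy.1.le hy.2.le (hexp n).le
  · refine Summable.of_norm_bounded
      ((summable_exp_tail lam β ε m hx hlam).norm.mul_right x) fun n => ?_
    rw [norm_mul, norm_mul, mul_assoc]
    refine mul_le_mul_of_nonneg_left ?_ (norm_nonneg _)
    have hpos := Real.rpow_pos_of_pos hx (β * (n : ℝ) + β - ε)
    rw [Real.rpow_add_one hx.ne', Real.norm_of_nonneg hpos.le,
      Real.norm_of_nonneg (div_nonneg (by positivity) (by linarith [hexp n]))]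
    exact div_le_self (by positivity) (by linarith [hexp n])

lemma sum_Icc_neg_natCast_neg_one (f : ℤ → ℝ) (m : ℕ) :
    ∑ n ∈ Finset.Icc (-(m : ℤ)) (-1 : ℤ), f n = ∑ k ∈ Finset.range m, f ((k : ℤ) - m) := by
  symm
  refine Finset.sum_bij (fun k _ => (k : ℤ) - m) ?_ ?_ ?_ ?_
  · intro k hk
    simp only [Finset.mem_range, Finset.mem_Icc] at *
    omega
  · intro a _ b _ h
    omega
  · intro b hb
    simp only [Finset.mem_Icc] at hb
    exact ⟨(b + m).toNat, by simp only [Finset.mem_range]; omega, by omega⟩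
  · intro k _
    rfl

/-- The exponential series divided by `lam * x ^ (β + α)`, grouped as in the derivative of `F`. -/
lemma exp_div_eq_sum (lam β ε : ℝ) (m : ℕ) (hlam : lam ≠ 0) {x : ℝ} (hx : 0 < x) :
    Real.exp (lam * x ^ β) / (lam * x ^ (β + (m * β + ε))) =
      1 / lam * x ^ (-β - (m * β + ε)) +
      lam ^ m / Real.Gamma ((m : ℝ) + 2) * x ^ (-ε) +
      (∑ n ∈ Finset.Icc (-(m : ℤ)) (-1 : ℤ),
        lam ^ (n + (m : ℤ)) / Real.Gamma ((n : ℝ) + (m : ℝ) + 2) * x ^ (β * (n : ℝ) - ε)) +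
      ∑' n : ℕ, lam ^ (n + m + 1) / Real.Gamma ((n : ℝ) + (m : ℝ) + 3) *
        x ^ (β * (n : ℝ) + β - ε) := by
  have hterm (k : ℕ) : lam ^ k / Real.Gamma ((k : ℝ) + 2) * x ^ (β * ((k : ℝ) - m) - ε) =
      (lam * x ^ β) ^ (k + 1) / ((k + 1).factorial : ℝ) /
        (lam * x ^ (β + (m * β + ε))) := by
    have hpow : (x ^ β) ^ (k + 1) =
        x ^ (β * ((k : ℝ) - m) - ε) * x ^ (β + (m * β + ε)) := by
      rw [← Real.rpow_natCast, ← Real.rpow_mul hx.le, ← Real.rpow_add hx]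
      push_cast
      congr 1
      ring
    have hx' := (Real.rpow_pos_of_pos hx (β + (m * β + ε))).ne'
    have hf : ((k + 1).factorial : ℝ) ≠ 0 := by positivity
    have hG : Real.Gamma ((k : ℝ) + 2) = ((k + 1).factorial : ℝ) := by
      rw [← Real.Gamma_nat_eq_factorial]
      push_cast
      congr 1
      ring
    rw [hG, mul_pow, hpow]
    field_simp
    ring
  have hzero : 1 / lam * x ^ (-β - (m * β + ε)) = 1 / (lam * x ^ (β + (m * β + ε))) := by
    rw [show -β - (m * β + ε) = -(β + (m * β + ε)) by ring, Real.rpow_neg hx.le]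
    field_simp
  have hmid : lam ^ m / Real.Gamma ((m : ℝ) + 2) * x ^ (-ε) =
      (lam * x ^ β) ^ (m + 1) / ((m + 1).factorial : ℝ) /
        (lam * x ^ (β + (m * β + ε))) := by
    rw [← hterm m, sub_self, mul_zero, zero_sub]
  have hfin : (∑ n ∈ Finset.Icc (-(m : ℤ)) (-1 : ℤ),
      lam ^ (n + (m : ℤ)) / Real.Gamma ((n : ℝ) + (m : ℝ) + 2) * x ^ (β * (n : ℝ) - ε)) =
      ∑ k ∈ Finset.range m, (lam * x ^ β) ^ (k + 1) / ((k + 1).factorial : ℝ) /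
        (lam * x ^ (β + (m * β + ε))) := by
    rw [sum_Icc_neg_natCast_neg_one]
    refine Finset.sum_congr rfl fun k _ => ?_
    rw [← hterm k]
    push_cast
    rw [sub_add_cancel, sub_add_cancel, zpow_natCast]
  have hexp : Real.exp (lam * x ^ β) =
      ∑' n : ℕ, (lam * x ^ β) ^ n / (n.factorial : ℝ) := by
    rw [Real.exp_eq_exp_ℝ, NormedSpace.exp_eq_tsum_div]
  rw [hzero, hmid, hfin, hexp, tsum_congr fun n => exp_tail_term lam β ε m n hx hlam,
    tsum_div_const, ← Finset.sum_div,
    ← (Real.summable_pow_div_factorial (lam * x ^ β)).sum_add_tsum_nat_add (m + 2),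
    Finset.sum_range_succ, Finset.sum_range_succ']
  simp only [pow_zero, Nat.factorial_zero, Nat.cast_one, div_one]
  ring

/-- Theorem 5, case ε ∈ (-β,0)∪(0,1)∪(1,β) (exponential integral with `α = mβ + ε`). -/
theorem exp_integral_eps_general (lam β α ε : ℝ) (hlam : lam ≠ 0) (hβ : 1 ≤ β) (hα : 1 < α)
    (m : ℕ) (hε₁ : -β < ε) (hε₂ : ε < β) (hε₀ : ε ≠ 0) (hε₃ : ε ≠ 1)
    (hαm : α = m * β + ε)
    (hden : ∀ n : ℤ, -(m : ℤ) ≤ n → n ≤ -1 → ε ≠ β * (n : ℝ) + 1) :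
    ∀ x : ℝ, 0 < x →
      HasDerivAt (fun y : ℝ =>
        (1 / lam) * (y ^ (1 - β - α) / (1 - β - α)) +
        (lam ^ m / Real.Gamma ((m : ℝ) + 2)) * (y ^ (1 - ε) / (1 - ε)) +
        (∑ n ∈ Finset.Icc (-(m : ℤ)) (-1 : ℤ),
          (lam ^ (n + (m : ℤ)) / Real.Gamma ((n : ℝ) + (m : ℝ) + 2)) *
            (y ^ (β * (n : ℝ) - ε + 1) / (β * (n : ℝ) - ε + 1))) +
        ∑' n : ℕ,
          (lam ^ (n + m + 1) / Real.Gamma ((n : ℝ) + (m : ℝ) + 3)) *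
            (y ^ (β * (n : ℝ) + β - ε + 1) / (β * (n : ℝ) + β - ε + 1)))
        (Real.exp (lam * x ^ β) / (lam * x ^ (β + α))) x := by
  intro x hx
  subst hαm
  rw [exp_div_eq_sum lam β ε m hlam hx]
  refine HasDerivAt.add (HasDerivAt.add (HasDerivAt.add ?_ ?_) ?_)
    (hasDerivAt_tsum_exp_tail lam β ε m hlam (by linarith) hε₂ hx)
  · have h := hasDerivAt_rpow_div hx (s := 1 - β - (m * β + ε)) (by linarith)
    rw [show 1 - β - (m * β + ε) - 1 = -β - (m * β + ε) by ring] at h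
    exact h.const_mul _
  · have h := hasDerivAt_rpow_div hx (sub_ne_zero.2 hε₃.symm)
    rw [show 1 - ε - 1 = -ε by ring] at h
    exact h.const_mul _
  · refine HasDerivAt.fun_sum fun n hn => ?_
    rw [Finset.mem_Icc] at hn
    have hs : β * (n : ℝ) - ε + 1 ≠ 0 := fun h => hden n hn.1 hn.2 (by linarith)
    have h := hasDerivAt_rpow_div hx hs
    rw [add_sub_cancel_right] at h
    exact h.const_mul _
end

section
/- Let λ be a nonzero real number and let α be an integer with α ≥ 2; set m = α - 1. Define, for y > 0, F(y) = -1/(λ α y^{α}) + (λ^{m}/Γ(m+2)) · log y + ∑_{n=-m}^{-1} (λ^{n+m}/Γ(n+m+2)) · y^{n}/n + ∑_{n=0}^{∞} (λ^{n+m+1}/Γ(n+m+3)) · y^{n+1}/(n+1). Then for every x > 0, F is differentiable at x and F′(x) = exp(λ x)/(λ x^{1+α}). -/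
open Real

/-- Termwise antiderivative of an everywhere absolutely convergent power series. -/
theorem hasDerivAt_tsum_mul_pow_succ_div {c : ℕ → ℝ}
    (hc : ∀ r : ℝ, Summable fun n => c n * r ^ n) (x : ℝ) :
    HasDerivAt (fun y : ℝ => ∑' n : ℕ, c n * (y ^ (n + 1) / ((n : ℝ) + 1)))
      (∑' n : ℕ, c n * x ^ n) x := by
  have hx : x ∈ Metric.ball (0 : ℝ) (|x| + 1) := by simp
  refine hasDerivAt_tsum_of_isPreconnected (hc (|x| + 1)).norm Metric.isOpen_ball
    (convex_ball (0 : ℝ) (|x| + 1)).isPreconnected (g' := fun n y => c n * y ^ n)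
    (fun n y _ => ?_) (fun n y hy => ?_) (Metric.mem_ball_self (by positivity)) ?_ hx
  · have hn : (n : ℝ) + 1 ≠ 0 := by positivity
    refine (((hasDerivAt_pow (n + 1) y).div_const ((n : ℝ) + 1)).const_mul (c n)).congr_deriv ?_
    rw [Nat.add_sub_cancel]
    push_cast
    field_simp
  · rw [mem_ball_zero_iff, Real.norm_eq_abs] at hy
    rw [norm_mul, norm_mul, norm_pow, norm_pow]
    gcongr
    rw [Real.norm_eq_abs, Real.norm_eq_abs, abs_of_nonneg (by positivity : 0 ≤ |x| + 1)]
    exact hy.le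
  · simp

theorem hasSum_exp_factorial (z : ℝ) :
    HasSum (fun n : ℕ => z ^ n / (n.factorial : ℝ)) (Real.exp z) := by
  rw [Real.exp_eq_exp_ℝ]
  exact NormedSpace.expSeries_div_hasSum_exp z

/-- The tail of the exponential series, divided by a power of the variable. -/
theorem summable_pow_div_factorial_mul_pow (lam r : ℝ) (k : ℕ) :
    Summable fun n : ℕ => lam ^ (n + k) / ((n + k + 1).factorial : ℝ) * r ^ n := by
  refine Summable.of_norm_bounded
    (((hasSum_exp_factorial (|lam| * |r|)).summable).mul_left (|lam| ^ k)) fun n => ?_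
  have hf : (n.factorial : ℝ) ≤ ((n + k + 1).factorial : ℝ) := by
    exact_mod_cast Nat.factorial_le (by omega)
  have hn : (0 : ℝ) < n.factorial := by positivity
  rw [norm_mul, norm_div, norm_pow, norm_pow, Real.norm_natCast, Real.norm_eq_abs,
    Real.norm_eq_abs]
  calc |lam| ^ (n + k) / ((n + k + 1).factorial : ℝ) * |r| ^ n
      ≤ |lam| ^ (n + k) / (n.factorial : ℝ) * |r| ^ n := by gcongr
    _ = |lam| ^ k * ((|lam| * |r|) ^ n / (n.factorial : ℝ)) := by ring

theorem exp_div_mul_pow_eq_add_tsum {lam x : ℝ} (hlam : lam ≠ 0) (hx : x ≠ 0) (M : ℕ) :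
    Real.exp (lam * x) / (lam * x ^ (M + 2)) =
      1 / (lam * x ^ (M + 2)) + lam ^ M / ((M + 1).factorial : ℝ) * x⁻¹ +
      ∑ k ∈ Finset.range M,
        lam ^ k / ((k + 1).factorial : ℝ) * x ^ ((k : ℤ) - (M : ℤ) - 1) +
      ∑' n : ℕ, lam ^ (n + (M + 1)) / ((n + (M + 1) + 1).factorial : ℝ) * x ^ n := by
  have hs := hasSum_exp_factorial (lam * x)
  rw [← hs.tsum_eq, ← hs.summable.sum_add_tsum_nat_add (M + 2), add_div, ← tsum_div_const,
    Finset.sum_range_succ', Finset.sum_range_succ, add_div, add_div, Finset.sum_div]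
  have htail : ∀ n : ℕ, (lam * x) ^ (n + (M + 2)) / ((n + (M + 2)).factorial : ℝ) /
      (lam * x ^ (M + 2)) =
      lam ^ (n + (M + 1)) / ((n + (M + 1) + 1).factorial : ℝ) * x ^ n := by
    intro n
    rw [show n + (M + 2) = n + (M + 1) + 1 by ring]
    have : ((n + (M + 1) + 1).factorial : ℝ) ≠ 0 := by positivity
    field_simp
    ring
  have hhead : ∀ k : ℕ, (lam * x) ^ (k + 1) / ((k + 1).factorial : ℝ) / (lam * x ^ (M + 2)) =
      lam ^ k / ((k + 1).factorial : ℝ) * x ^ ((k : ℤ) - (M : ℤ) - 1) := by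
    intro k
    have : ((k + 1).factorial : ℝ) ≠ 0 := by positivity
    rw [show (k : ℤ) - (M : ℤ) - 1 = ((k + 1 : ℕ) : ℤ) - ((M + 2 : ℕ) : ℤ) by push_cast; ring,
      zpow_sub₀ hx, zpow_natCast, zpow_natCast]
    field_simp
    ring
  simp only [htail, hhead]
  simp
  ring

/-- Corollary 1, part 1 (exponential integral `Ei_{1,1+α}`, integer `α ≥ 2`, `m = α - 1`). -/
theorem exp_integral_corollary_int (lam : ℝ) (hlam : lam ≠ 0) (α : ℤ) (hα : 2 ≤ α)
    (m : ℤ) (hm : m = α - 1) :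
    ∀ x : ℝ, 0 < x →
      HasDerivAt (fun y : ℝ =>
        -(1 / (lam * (α : ℝ) * y ^ (α : ℝ))) +
        (lam ^ m / Real.Gamma ((m : ℝ) + 2)) * Real.log y +
        (∑ n ∈ Finset.Icc (-m) (-1 : ℤ),
          (lam ^ (n + m) / Real.Gamma ((n : ℝ) + (m : ℝ) + 2)) *
            (y ^ (n : ℝ) / (n : ℝ))) +
        ∑' n : ℕ,
          (lam ^ ((n : ℤ) + m + 1) / Real.Gamma ((n : ℝ) + (m : ℝ) + 3)) *
            (y ^ ((n : ℝ) + 1) / ((n : ℝ) + 1)))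
        (Real.exp (lam * x) / (lam * x ^ (1 + (α : ℝ)))) x := by
  intro x hx
  obtain ⟨M, rfl⟩ : ∃ M : ℕ, m = M := ⟨m.toNat, by omega⟩
  obtain rfl : α = ((M + 1 : ℕ) : ℤ) := by push_cast; omega
  have hΓ (k : ℕ) (z : ℝ) (hz : z = (k : ℝ) + 1) : Real.Gamma z = (k.factorial : ℝ) := by
    rw [hz, Real.Gamma_nat_eq_factorial]
  have hx0 := hx.ne'
  have hexp : x ^ (1 + (((M + 1 : ℕ) : ℤ) : ℝ)) = x ^ (M + 2) := by
    rw [← Real.rpow_natCast]; congr 1; push_cast; ring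
  rw [hexp, exp_div_mul_pow_eq_add_tsum hlam hx0]
  refine ((HasDerivAt.add ?_ ?_).add ?_).add ?_
  · simp only [Int.cast_natCast, Real.rpow_natCast]
    have hM : ((M + 1 : ℕ) : ℝ) ≠ 0 := by positivity
    have hd := (((hasDerivAt_pow (M + 1) x).const_mul (lam * ((M + 1 : ℕ) : ℝ))).inv
      (by positivity)).neg
    simp only [one_div]
    refine hd.congr_deriv ?_
    rw [Nat.add_sub_cancel]
    field_simp
    ring
  · rw [zpow_natCast, hΓ (M + 1) _ (by push_cast; ring)]
    exact (Real.hasDerivAt_log hx0).const_mul _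
  · have hmap : Finset.Icc (-(M : ℤ)) (-1) =
        (Finset.range M).image fun k : ℕ => (k : ℤ) - (M : ℤ) := by
      ext n
      simp only [Finset.mem_Icc, Finset.mem_image, Finset.mem_range]
      exact ⟨fun h => ⟨(n + M).toNat, by omega, by omega⟩, by rintro ⟨k, hk, rfl⟩; omega⟩
    have hinj : Set.InjOn (fun k : ℕ => (k : ℤ) - (M : ℤ)) (Finset.range M) :=
      fun a _ b _ h => by simpa using h
    simp only [hmap, Finset.sum_image hinj, Real.rpow_intCast]
    refine HasDerivAt.fun_sum fun k hk => ?_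
    have hkM : (((k : ℤ) - (M : ℤ) : ℤ) : ℝ) ≠ 0 := by
      rw [Finset.mem_range] at hk
      exact_mod_cast (by omega : (k : ℤ) - (M : ℤ) ≠ 0)
    rw [sub_add_cancel, zpow_natCast, hΓ (k + 1) _ (by push_cast; ring)]
    refine (((hasDerivAt_zpow ((k : ℤ) - (M : ℤ)) x (Or.inl hx0)).div_const
      (((k : ℤ) - (M : ℤ) : ℤ) : ℝ)).const_mul
      (lam ^ k / ((k + 1).factorial : ℝ))).congr_deriv ?_
    rw [mul_div_cancel_left₀ _ hkM]
  · have hcoeff (n : ℕ) : lam ^ ((n : ℤ) + (M : ℤ) + 1) = lam ^ (n + (M + 1)) := by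
      rw [← zpow_natCast]; congr 1
    have hfact (n : ℕ) : Real.Gamma ((n : ℝ) + ((M : ℤ) : ℝ) + 3) =
        ((n + (M + 1) + 1).factorial : ℝ) := hΓ _ _ (by push_cast; ring)
    have hpow (y : ℝ) (n : ℕ) : y ^ ((n : ℝ) + 1) = y ^ (n + 1) := by
      rw [← Real.rpow_natCast]; push_cast; rfl
    simp only [hcoeff, hfact, hpow]
    exact hasDerivAt_tsum_mul_pow_succ_div
      (fun r => summable_pow_div_factorial_mul_pow lam r (M + 1)) x
end
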